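/- arXiv:2003.13169 — 2 statements merged into one kernel-verified Lean document; each statement's English description precedes it below -/
import Mathlib

section
/- If E ⊆ H₃ is a 3-dimensional subspace satisfying R_α·E = E for every α ∈ ℝ, then E equals one of A₁₂₃, A₁₄₅, A₁₆₇. Moreover each of the three subspaces A₁₂₃, A₁₄₅, A₁₆₇ is associative. -/
noncomputable section

open MvPolynomial Matrix

/-- The polynomial ring `ℝ[x,y,z]`. -/
abbrev P3 := MvPolynomial (Fin 3) ℝ

/-- `SO(3)`, realised as a set of real 3×3 matrices. -/
def SO3 : Set (Matrix (Fin 3) (Fin 3) ℝ) := {A | A * Aᵀ = 1 ∧ A.det = 1}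

/-- The substitution action of a matrix `A` on polynomials: `(A · p)(w) = p (A⁻¹ w)`,
i.e. the variable `Xᵢ` is replaced by `∑ⱼ (A⁻¹)ᵢⱼ Xⱼ`. -/
def sAct (A : Matrix (Fin 3) (Fin 3) ℝ) (p : P3) : P3 :=
  aeval (fun i => ∑ j, A⁻¹ i j • (X j : P3)) p

/-- The Laplace operator on polynomials in three variables. -/
def lap : P3 →ₗ[ℝ] P3 :=
  ∑ i : Fin 3, ((pderiv i).toLinearMap ∘ₗ (pderiv i).toLinearMap)

/-- `H₃`: the space of harmonic homogeneous cubic polynomials in `x, y, z`. -/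
def H3 : Submodule ℝ P3 :=
  homogeneousSubmodule (Fin 3) ℝ 3 ⊓ LinearMap.ker lap

/-- The orthonormal basis `e₁, …, e₇` of `H₃` (with `x = X 0`, `y = X 1`, `z = X 2`). -/
def eH : Fin 7 → P3 :=
  ![(1 / 5 : ℝ) • (X 0 * (2 * X 0 ^ 2 - 3 * X 1 ^ 2 - 3 * X 2 ^ 2)),
    (Real.sqrt 6 / 10) • (X 2 * (4 * X 0 ^ 2 - X 1 ^ 2 - X 2 ^ 2)),
    (Real.sqrt 6 / 10) • (X 1 * (4 * X 0 ^ 2 - X 1 ^ 2 - X 2 ^ 2)),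
    (2 * Real.sqrt 15 / 5) • (X 0 * X 1 * X 2),
    (Real.sqrt 15 / 5) • (X 0 * (X 1 ^ 2 - X 2 ^ 2)),
    (Real.sqrt 10 / 10) • (X 2 * (3 * X 1 ^ 2 - X 2 ^ 2)),
    (Real.sqrt 10 / 10) • (X 1 * (X 1 ^ 2 - 3 * X 2 ^ 2))]

/-- The identification of `ℝ⁷` (coordinates) with `H₃`, via the basis `e₁, …, e₇`. -/
def iotaH (v : Fin 7 → ℝ) : P3 := ∑ i, v i • eH i

/-- The subset of `H₃` corresponding to a coordinate subspace `E ⊆ ℝ⁷`. -/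
def polySet (E : Submodule ℝ (Fin 7 → ℝ)) : Set P3 := iotaH '' (E : Set (Fin 7 → ℝ))

/-- The inner product of `H₃` making `e₁, …, e₇` orthonormal, in coordinates. -/
def dot7 (u v : Fin 7 → ℝ) : ℝ := ∑ i, u i * v i

/-- The 3×3 minor determinant `(eⁱ ∧ eʲ ∧ eᵏ) (u, v, w)`. -/
def triD (u v w : Fin 7 → ℝ) (i j k : Fin 7) : ℝ :=
  Matrix.det !![u i, u j, u k; v i, v j, v k; w i, w j, w k]

/-- The 3-form `φ₀ = e¹²³ + e¹⁴⁵ − e¹⁶⁷ + e²⁴⁶ + e²⁵⁷ + e³⁴⁷ − e³⁵⁶`, in coordinates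
(indices shifted by one: `eᵢ = e (i-1)`). -/
def phi0 (u v w : Fin 7 → ℝ) : ℝ :=
  triD u v w 0 1 2 + triD u v w 0 3 4 - triD u v w 0 5 6 + triD u v w 1 3 5 +
    triD u v w 1 4 6 + triD u v w 2 3 6 - triD u v w 2 4 5

/-- A 3-dimensional subspace `E` of `H₃` (in coordinates) is associative if it has an
orthonormal basis `(u, v, w)` with `φ₀ (u, v, w) = ±1`. -/
def IsAssocSubspace (E : Submodule ℝ (Fin 7 → ℝ)) : Prop :=
  ∃ u v w : Fin 7 → ℝ, u ∈ E ∧ v ∈ E ∧ w ∈ E ∧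
    dot7 u u = 1 ∧ dot7 v v = 1 ∧ dot7 w w = 1 ∧
    dot7 u v = 0 ∧ dot7 u w = 0 ∧ dot7 v w = 0 ∧
    Submodule.span ℝ {u, v, w} = E ∧ (phi0 u v w = 1 ∨ phi0 u v w = -1)

/-- The subspace `E ⊆ H₃` is invariant under the substitution action of `A`: `A · E = E`. -/
def InvUnder (A : Matrix (Fin 3) (Fin 3) ℝ) (E : Submodule ℝ (Fin 7 → ℝ)) : Prop :=
  sAct A '' polySet E = polySet E

/-- The `SO(3)`-stabiliser of a subspace `E ⊆ H₃`: `{A ∈ SO(3) | A · E = E}`. -/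
def stabSO3 (E : Submodule ℝ (Fin 7 → ℝ)) : Set (Matrix (Fin 3) (Fin 3) ℝ) :=
  {A | A ∈ SO3 ∧ InvUnder A E}

/-- The subset `S` of a monoid is a subgroup isomorphic to the group `G`. -/
def SetIsoGroup {M : Type*} [Monoid M] (S : Set M) (G : Type*) [Group G] : Prop :=
  ∃ f : G → M, Function.Injective f ∧ (∀ a b, f (a * b) = f a * f b) ∧ Set.range f = S

/-- The rotation `R_α` about the x-axis through the angle `α`. -/
def Rmat (α : ℝ) : Matrix (Fin 3) (Fin 3) ℝ :=
  !![1, 0, 0; 0, Real.cos α, -Real.sin α; 0, Real.sin α, Real.cos α]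

/-- `A₁₂₃ = span (e₁, e₂, e₃)`, in coordinates. -/
def A123 : Submodule ℝ (Fin 7 → ℝ) :=
  Submodule.span ℝ {![1, 0, 0, 0, 0, 0, 0], ![0, 1, 0, 0, 0, 0, 0], ![0, 0, 1, 0, 0, 0, 0]}

/-- `A₁₄₅ = span (e₁, e₄, e₅)`, in coordinates. -/
def A145 : Submodule ℝ (Fin 7 → ℝ) :=
  Submodule.span ℝ {![1, 0, 0, 0, 0, 0, 0], ![0, 0, 0, 1, 0, 0, 0], ![0, 0, 0, 0, 1, 0, 0]}

/-- `A₁₆₇ = span (e₁, e₆, e₇)`, in coordinates. -/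
def A167 : Submodule ℝ (Fin 7 → ℝ) :=
  Submodule.span ℝ {![1, 0, 0, 0, 0, 0, 0], ![0, 0, 0, 0, 0, 1, 0], ![0, 0, 0, 0, 0, 0, 1]}

/-- The action of the rotation `R_α` on `H₃` in the coordinates given by `e₁, …, e₇`. -/
def rot7 (α : ℝ) (v : Fin 7 → ℝ) : Fin 7 → ℝ :=
  ![v 0,
    Real.cos α * v 1 + Real.sin α * v 2,
    -Real.sin α * v 1 + Real.cos α * v 2,
    Real.cos (2 * α) * v 3 + Real.sin (2 * α) * v 4,
    -Real.sin (2 * α) * v 3 + Real.cos (2 * α) * v 4,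
    Real.cos (3 * α) * v 5 + Real.sin (3 * α) * v 6,
    -Real.sin (3 * α) * v 5 + Real.cos (3 * α) * v 6]

theorem Rmat_inv (α : ℝ) : (Rmat α)⁻¹ = Rmat (-α) := by
  apply Matrix.inv_eq_right_inv
  have h := Real.sin_sq_add_cos_sq α
  ext i j
  fin_cases i <;> fin_cases j <;>
    simp [Rmat, Matrix.mul_apply, Fin.sum_univ_succ] <;> linarith

theorem eval_iotaH (v : Fin 7 → ℝ) (q : Fin 3 → ℝ) :
    eval q (iotaH v) =
      v 0 * (1 / 5 * (q 0 * (2 * q 0 ^ 2 - 3 * q 1 ^ 2 - 3 * q 2 ^ 2))) +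
      v 1 * (Real.sqrt 6 / 10 * (q 2 * (4 * q 0 ^ 2 - q 1 ^ 2 - q 2 ^ 2))) +
      v 2 * (Real.sqrt 6 / 10 * (q 1 * (4 * q 0 ^ 2 - q 1 ^ 2 - q 2 ^ 2))) +
      v 3 * (2 * Real.sqrt 15 / 5 * (q 0 * q 1 * q 2)) +
      v 4 * (Real.sqrt 15 / 5 * (q 0 * (q 1 ^ 2 - q 2 ^ 2))) +
      v 5 * (Real.sqrt 10 / 10 * (q 2 * (3 * q 1 ^ 2 - q 2 ^ 2))) +
      v 6 * (Real.sqrt 10 / 10 * (q 1 * (q 1 ^ 2 - 3 * q 2 ^ 2))) := by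
  simp [iotaH, eH, Fin.sum_univ_seven, smul_eval]

theorem eval_sAct (A : Matrix (Fin 3) (Fin 3) ℝ) (p : P3) (q : Fin 3 → ℝ) :
    eval q (sAct A p) = eval (A⁻¹ *ᵥ q) p := by
  have h : (aeval q : P3 →ₐ[ℝ] ℝ).comp (aeval fun i => ∑ j, A⁻¹ i j • (X j : P3)) =
      aeval (A⁻¹ *ᵥ q) := by
    ext i
    simp [Matrix.mulVec, dotProduct]
  simpa [sAct, aeval_eq_eval] using DFunLike.congr_fun h p

theorem sAct_Rmat_iotaH (α : ℝ) (v : Fin 7 → ℝ) :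
    sAct (Rmat α) (iotaH v) = iotaH (rot7 α v) := by
  have hc : Real.cos (3 * α) = Real.cos α ^ 3 - 3 * Real.cos α * Real.sin α ^ 2 := by
    rw [Real.cos_three_mul]
    linear_combination 3 * Real.cos α * Real.sin_sq_add_cos_sq α
  have hs : Real.sin (3 * α) = 3 * Real.cos α ^ 2 * Real.sin α - Real.sin α ^ 3 := by
    rw [Real.sin_three_mul]
    linear_combination -3 * Real.sin α * Real.sin_sq_add_cos_sq α
  refine MvPolynomial.funext fun q => ?_
  rw [eval_sAct, Rmat_inv, eval_iotaH, eval_iotaH]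
  have h0 : (Rmat (-α) *ᵥ q) 0 = q 0 := by
    simp [Rmat, Matrix.mulVec, dotProduct, Fin.sum_univ_three]
  have h1 : (Rmat (-α) *ᵥ q) 1 = Real.cos α * q 1 + Real.sin α * q 2 := by
    simp [Rmat, Matrix.mulVec, dotProduct, Fin.sum_univ_three]
  have h2 : (Rmat (-α) *ᵥ q) 2 = -Real.sin α * q 1 + Real.cos α * q 2 := by
    simp [Rmat, Matrix.mulVec, dotProduct, Fin.sum_univ_three]
  rw [h0, h1, h2]
  simp only [rot7, hc, hs, Real.cos_two_mul', Real.sin_two_mul, Matrix.cons_val]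
  linear_combination (-(q 1 ^ 2 + q 2 ^ 2)) * (v 0 * (3 / 5) * q 0 +
    v 1 * (Real.sqrt 6 / 10) * (-Real.sin α * q 1 + Real.cos α * q 2) +
    v 2 * (Real.sqrt 6 / 10) * (Real.cos α * q 1 + Real.sin α * q 2)) *
    Real.sin_sq_add_cos_sq α

theorem iotaH_injective : Function.Injective iotaH := by
  intro u w h
  have key : ∀ x y z : ℝ, eval ![x, y, z] (iotaH u) = eval ![x, y, z] (iotaH w) := by
    simp [h]
  simp only [eval_iotaH, Matrix.cons_val] at key
  have a1 := key 1 0 0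
  have a2 := key 0 0 1
  have a3 := key 1 0 1
  have a4 := key (-1) 0 1
  have a5 := key 0 1 0
  have a6 := key 1 1 0
  have a7 := key 1 1 1
  have s6 : Real.sqrt 6 ≠ 0 := by positivity
  have s10 : Real.sqrt 10 ≠ 0 := by positivity
  have s15 : Real.sqrt 15 ≠ 0 := by positivity
  ext i
  fin_cases i
  · change u 0 = w 0; linarith
  · refine mul_right_cancel₀ s6 (?_ : u 1 * _ = w 1 * _); linarith
  · refine mul_right_cancel₀ s6 (?_ : u 2 * _ = w 2 * _); linarith
  · refine mul_right_cancel₀ s15 (?_ : u 3 * _ = w 3 * _); linarith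
  · refine mul_right_cancel₀ s15 (?_ : u 4 * _ = w 4 * _); linarith
  · refine mul_right_cancel₀ s10 (?_ : u 5 * _ = w 5 * _); linarith
  · refine mul_right_cancel₀ s10 (?_ : u 6 * _ = w 6 * _); linarith

theorem rot7_mem {E : Submodule ℝ (Fin 7 → ℝ)} {α : ℝ} (h : InvUnder (Rmat α) E)
    {v : Fin 7 → ℝ} (hv : v ∈ E) : rot7 α v ∈ E := by
  have h' : iotaH (rot7 α v) ∈ polySet E := by
    rw [← h, ← sAct_Rmat_iotaH]
    exact ⟨_, ⟨v, hv, rfl⟩, rfl⟩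
  obtain ⟨u, hu, e⟩ := h'
  exact iotaH_injective e ▸ hu

theorem rot7_pi (v : Fin 7 → ℝ) :
    rot7 Real.pi v = ![v 0, -v 1, -v 2, v 3, v 4, -v 5, -v 6] := by
  simp [rot7, Real.cos_three_mul, Real.sin_three_mul]
  norm_num

theorem rot7_pi_div_two (v : Fin 7 → ℝ) :
    rot7 (Real.pi / 2) v = ![v 0, v 2, -v 1, -v 3, -v 4, -v 6, v 5] := by
  simp [rot7, Real.cos_three_mul, Real.sin_three_mul, Real.cos_two_mul, Real.sin_two_mul]
  norm_num

theorem rot7_pi_div_three_add_neg (v : Fin 7 → ℝ) :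
    rot7 (Real.pi / 3) v + rot7 (-(Real.pi / 3)) v =
      ![2 * v 0, v 1, v 2, -v 3, -v 4, -2 * v 5, -2 * v 6] := by
  have h3 : 3 * (Real.pi / 3) = Real.pi := by ring
  simp [rot7, h3, Real.cos_two_mul, Real.sin_two_mul]
  norm_num
  refine ⟨?_, ?_, ?_, ?_, ?_, ?_, ?_⟩ <;> ring

theorem even_part_mem {E : Submodule ℝ (Fin 7 → ℝ)}
    (h : ∀ α, ∀ v ∈ E, rot7 α v ∈ E) {v : Fin 7 → ℝ} (hv : v ∈ E) :
    ![v 0, 0, 0, v 3, v 4, 0, 0] ∈ E := by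
  convert E.smul_mem (1 / 2) (E.add_mem hv (h Real.pi v hv)) using 1
  rw [rot7_pi]
  ext i
  fin_cases i <;> simp [-Matrix.add_cons] <;> ring

theorem odd_part_mem {E : Submodule ℝ (Fin 7 → ℝ)}
    (h : ∀ α, ∀ v ∈ E, rot7 α v ∈ E) {v : Fin 7 → ℝ} (hv : v ∈ E) :
    ![0, v 1, v 2, 0, 0, v 5, v 6] ∈ E := by
  convert E.sub_mem hv (even_part_mem h hv) using 1
  ext i
  fin_cases i <;> simp

theorem weight_one_part_mem {E : Submodule ℝ (Fin 7 → ℝ)}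
    (h : ∀ α, ∀ v ∈ E, rot7 α v ∈ E) {v : Fin 7 → ℝ} (hv : v ∈ E) :
    ![0, v 1, v 2, 0, 0, 0, 0] ∈ E := by
  have hw := odd_part_mem h hv
  have hs := E.add_mem (h (Real.pi / 3) _ hw) (h (-(Real.pi / 3)) _ hw)
  rw [rot7_pi_div_three_add_neg] at hs
  convert E.smul_mem (1 / 3) (E.add_mem (E.smul_mem 2 hw) hs) using 1
  ext i
  fin_cases i <;> simp <;> ring

theorem weight_two_part_mem {E : Submodule ℝ (Fin 7 → ℝ)}
    (h : ∀ α, ∀ v ∈ E, rot7 α v ∈ E) {v : Fin 7 → ℝ} (hv : v ∈ E) :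
    ![0, 0, 0, v 3, v 4, 0, 0] ∈ E := by
  have hw := even_part_mem h hv
  have hs := E.sub_mem hw (h (Real.pi / 2) _ hw)
  rw [rot7_pi_div_two] at hs
  convert E.smul_mem (1 / 2) hs using 1
  ext i
  fin_cases i <;> simp <;> ring

theorem weight_three_part_mem {E : Submodule ℝ (Fin 7 → ℝ)}
    (h : ∀ α, ∀ v ∈ E, rot7 α v ∈ E) {v : Fin 7 → ℝ} (hv : v ∈ E) :
    ![0, 0, 0, 0, 0, v 5, v 6] ∈ E := by
  convert E.sub_mem (odd_part_mem h hv) (weight_one_part_mem h hv) using 1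
  ext i
  fin_cases i <;> simp

theorem basis_vectors_mem_of_quarter_turn {E : Submodule ℝ (Fin 7 → ℝ)} {a b : ℝ} {i j : Fin 7}
    (h₁ : a • Pi.single i 1 + b • Pi.single j 1 ∈ E)
    (h₂ : b • Pi.single i 1 - a • Pi.single j 1 ∈ E) (hab : ¬(a = 0 ∧ b = 0)) :
    Pi.single i 1 ∈ E ∧ Pi.single j 1 ∈ E := by
  have hne : a ^ 2 + b ^ 2 ≠ 0 := fun h0 => hab ⟨by nlinarith, by nlinarith⟩
  constructor
  · refine (E.smul_mem_iff hne).1 ?_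
    convert E.add_mem (E.smul_mem a h₁) (E.smul_mem b h₂) using 1
    module
  · refine (E.smul_mem_iff hne).1 ?_
    convert E.sub_mem (E.smul_mem b h₁) (E.smul_mem a h₂) using 1
    module

theorem weight_one_block_mem {E : Submodule ℝ (Fin 7 → ℝ)}
    (h : ∀ α, ∀ v ∈ E, rot7 α v ∈ E) {v : Fin 7 → ℝ} (hv : v ∈ E)
    (hne : ¬(v 1 = 0 ∧ v 2 = 0)) : Pi.single 1 1 ∈ E ∧ Pi.single 2 1 ∈ E := by
  have hw := weight_one_part_mem h hv
  refine basis_vectors_mem_of_quarter_turn ?_ ?_ hne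
  · convert hw using 1
    ext i
    fin_cases i <;> simp
  · convert E.smul_mem 1 (h (Real.pi / 2) _ hw) using 1
    ext i
    fin_cases i <;> simp [rot7_pi_div_two]

theorem weight_two_block_mem {E : Submodule ℝ (Fin 7 → ℝ)}
    (h : ∀ α, ∀ v ∈ E, rot7 α v ∈ E) {v : Fin 7 → ℝ} (hv : v ∈ E)
    (hne : ¬(v 3 = 0 ∧ v 4 = 0)) : Pi.single 3 1 ∈ E ∧ Pi.single 4 1 ∈ E := by
  have hw := weight_two_part_mem h hv
  have e : 2 * (Real.pi / 4) = Real.pi / 2 := by ring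
  refine basis_vectors_mem_of_quarter_turn ?_ ?_ hne
  · convert hw using 1
    ext i
    fin_cases i <;> simp
  · convert E.smul_mem 1 (h (Real.pi / 4) _ hw) using 1
    ext i
    fin_cases i <;> simp [rot7, e]

theorem weight_three_block_mem {E : Submodule ℝ (Fin 7 → ℝ)}
    (h : ∀ α, ∀ v ∈ E, rot7 α v ∈ E) {v : Fin 7 → ℝ} (hv : v ∈ E)
    (hne : ¬(v 5 = 0 ∧ v 6 = 0)) : Pi.single 5 1 ∈ E ∧ Pi.single 6 1 ∈ E := by
  have hw := weight_three_part_mem h hv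
  refine basis_vectors_mem_of_quarter_turn ?_ ?_ hne
  · convert hw using 1
    ext i
    fin_cases i <;> simp
  · convert E.smul_mem (-1) (h (Real.pi / 2) _ hw) using 1
    ext i
    fin_cases i <;> simp [rot7_pi_div_two]

theorem card_le_finrank_of_single_mem {E : Submodule ℝ (Fin 7 → ℝ)} (s : Finset (Fin 7))
    (hs : ∀ i ∈ s, Pi.single i (1 : ℝ) ∈ E) : s.card ≤ Module.finrank ℝ E := by
  have hli : LinearIndependent ℝ fun i : s => (⟨Pi.single i.1 1, hs i.1 i.2⟩ : E) := by
    apply LinearIndependent.of_comp E.subtype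
    simpa [Function.comp_def] using
      (Pi.basisFun ℝ (Fin 7)).linearIndependent.comp (Subtype.val : s → Fin 7)
        Subtype.val_injective
  simpa using hli.fintype_card_le_finrank

theorem span_triple_eq_of_le {E : Submodule ℝ (Fin 7 → ℝ)} (hE : Module.finrank ℝ E = 3)
    {a b c : Fin 7 → ℝ} (hle : E ≤ Submodule.span ℝ {a, b, c}) :
    E = Submodule.span ℝ {a, b, c} := by
  classical
  refine Submodule.eq_of_le_of_finrank_le hle ?_
  have := finrank_span_finset_le_card (R := ℝ) ({a, b, c} : Finset (Fin 7 → ℝ))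
  simp only [Finset.coe_insert, Finset.coe_singleton] at this
  exact hE ▸ this.trans Finset.card_le_three

theorem eq_A123_of_coords_eq_zero {E : Submodule ℝ (Fin 7 → ℝ)} (hE : Module.finrank ℝ E = 3)
    (h₁ : ∀ v ∈ E, v 3 = 0 ∧ v 4 = 0) (h₂ : ∀ v ∈ E, v 5 = 0 ∧ v 6 = 0) :
    E = A123 := by
  refine span_triple_eq_of_le hE fun v hv => ?_
  obtain ⟨ha, hb⟩ := h₁ v hv
  obtain ⟨hc, hd⟩ := h₂ v hv
  refine Submodule.mem_span_triple.2 ⟨v 0, v 1, v 2, ?_⟩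
  ext k
  fin_cases k <;> simp [*]

theorem eq_A145_of_coords_eq_zero {E : Submodule ℝ (Fin 7 → ℝ)} (hE : Module.finrank ℝ E = 3)
    (h₁ : ∀ v ∈ E, v 1 = 0 ∧ v 2 = 0) (h₂ : ∀ v ∈ E, v 5 = 0 ∧ v 6 = 0) :
    E = A145 := by
  refine span_triple_eq_of_le hE fun v hv => ?_
  obtain ⟨ha, hb⟩ := h₁ v hv
  obtain ⟨hc, hd⟩ := h₂ v hv
  refine Submodule.mem_span_triple.2 ⟨v 0, v 3, v 4, ?_⟩
  ext k
  fin_cases k <;> simp [*]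

theorem eq_A167_of_coords_eq_zero {E : Submodule ℝ (Fin 7 → ℝ)} (hE : Module.finrank ℝ E = 3)
    (h₁ : ∀ v ∈ E, v 1 = 0 ∧ v 2 = 0) (h₂ : ∀ v ∈ E, v 3 = 0 ∧ v 4 = 0) :
    E = A167 := by
  refine span_triple_eq_of_le hE fun v hv => ?_
  obtain ⟨ha, hb⟩ := h₁ v hv
  obtain ⟨hc, hd⟩ := h₂ v hv
  refine Submodule.mem_span_triple.2 ⟨v 0, v 5, v 6, ?_⟩
  ext k
  fin_cases k <;> simp [*]

theorem not_four_single_mem {E : Submodule ℝ (Fin 7 → ℝ)} (hE : Module.finrank ℝ E = 3)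
    {i j k l : Fin 7} (hij : Pi.single i (1 : ℝ) ∈ E ∧ Pi.single j (1 : ℝ) ∈ E)
    (hkl : Pi.single k (1 : ℝ) ∈ E ∧ Pi.single l (1 : ℝ) ∈ E) :
    ({i, j, k, l} : Finset (Fin 7)).card ≠ 4 := by
  intro hc
  have := card_le_finrank_of_single_mem (E := E) {i, j, k, l} (by simp [hij, hkl])
  omega

/-- A 3-dimensional subspace of `H₃` invariant under every rotation `R_α`
about the x-axis equals one of `A₁₂₃`, `A₁₄₅`, `A₁₆₇`; and these three subspaces are
associative. -/
theorem stmt1 :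
    (∀ E : Submodule ℝ (Fin 7 → ℝ), Module.finrank ℝ E = 3 →
        (∀ α : ℝ, InvUnder (Rmat α) E) → E = A123 ∨ E = A145 ∨ E = A167) ∧
    IsAssocSubspace A123 ∧ IsAssocSubspace A145 ∧ IsAssocSubspace A167 := by
  refine ⟨fun E hE hinv => ?_, ?_, ?_, ?_⟩
  · have h : ∀ α, ∀ v ∈ E, rot7 α v ∈ E := fun α v hv => rot7_mem (hinv α) hv
    have block {i j : Fin 7} (hb : ∀ v ∈ E, ¬(v i = 0 ∧ v j = 0) →
        Pi.single i (1 : ℝ) ∈ E ∧ Pi.single j (1 : ℝ) ∈ E) :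
        (∀ v ∈ E, v i = 0 ∧ v j = 0) ∨ (Pi.single i (1 : ℝ) ∈ E ∧ Pi.single j (1 : ℝ) ∈ E) := by
      by_contra! hcon
      obtain ⟨⟨v, hv, hne⟩, hcon⟩ := hcon
      have := hb v hv fun h0 => hne h0.1 h0.2
      exact hcon this.1 this.2
    rcases block fun v hv => weight_one_block_mem h hv with h₁ | h₁ <;>
      rcases block fun v hv => weight_two_block_mem h hv with h₂ | h₂
    · exact .inr (.inr (eq_A167_of_coords_eq_zero hE h₁ h₂))
    · rcases block fun v hv => weight_three_block_mem h hv with h₃ | h₃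
      · exact .inr (.inl (eq_A145_of_coords_eq_zero hE h₁ h₃))
      · exact absurd (by decide) (not_four_single_mem hE h₂ h₃)
    · rcases block fun v hv => weight_three_block_mem h hv with h₃ | h₃
      · exact .inl (eq_A123_of_coords_eq_zero hE h₂ h₃)
      · exact absurd (by decide) (not_four_single_mem hE h₁ h₃)
    · exact absurd (by decide) (not_four_single_mem hE h₁ h₂)
  · refine ⟨![1, 0, 0, 0, 0, 0, 0], ![0, 1, 0, 0, 0, 0, 0],
      ![0, 0, 1, 0, 0, 0, 0], Submodule.subset_span (by simp),
      Submodule.subset_span (by simp), Submodule.subset_span (by simp),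
      ?_, ?_, ?_, ?_, ?_, ?_, rfl, ?_⟩ <;>
    simp [dot7, phi0, triD, Matrix.det_fin_three, Fin.sum_univ_seven]
  · refine ⟨![1, 0, 0, 0, 0, 0, 0], ![0, 0, 0, 1, 0, 0, 0],
      ![0, 0, 0, 0, 1, 0, 0], Submodule.subset_span (by simp),
      Submodule.subset_span (by simp), Submodule.subset_span (by simp),
      ?_, ?_, ?_, ?_, ?_, ?_, rfl, ?_⟩ <;>
    simp [dot7, phi0, triD, Matrix.det_fin_three, Fin.sum_univ_seven]
  · refine ⟨![1, 0, 0, 0, 0, 0, 0], ![0, 0, 0, 0, 0, 1, 0],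
      ![0, 0, 0, 0, 0, 0, 1], Submodule.subset_span (by simp),
      Submodule.subset_span (by simp), Submodule.subset_span (by simp),
      ?_, ?_, ?_, ?_, ?_, ?_, rfl, ?_⟩ <;>
    simp [dot7, phi0, triD, Matrix.det_fin_three, Fin.sum_univ_seven]
end
end

section
/- The following hold: (i) H₃ = A_Oct ⊕ ℝe₄ ⊕ W, and each summand is invariant under the substitution action of every element of Oct; (ii) every 3-dimensional Oct-invariant subspace of H₃ equals A_Oct or W; (iii) A_Oct equals the span of the harmonic parts of x³, y³ and z³ (where the harmonic part of q is q − (3/5)(x²+y²+z²)ℓ for the appropriate linear form ℓ, i.e. the harmonic part of x³ is x³ − (3/5)(x²+y²+z²)x, and similarly for y³, z³); (iv) A_Oct is associative while W is not associative; (v) the SO(3)-stabiliser of A_Oct equals Oct, which is isomorphic to the symmetric group S₄. -/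
noncomputable section

open MvPolynomial Matrix

/-- The octahedral group `Oct ≅ S₄ ⊂ SO(3)`: the group (= multiplicative closure, as all
generators have finite order) generated by the three listed rotations. -/
def OctSet : Set (Matrix (Fin 3) (Fin 3) ℝ) :=
  (Submonoid.closure {!![0, -1, 0; 1, 0, 0; 0, 0, 1], !![0, 0, 1; 1, 0, 0; 0, 1, 0],
      !![-1, 0, 0; 0, 0, 1; 0, 1, 0]} : Submonoid (Matrix (Fin 3) (Fin 3) ℝ))

/-- `A_Oct = span (e₁, √3e₂+√5e₆, √3e₃−√5e₇)`, in coordinates. -/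
def AOct : Submodule ℝ (Fin 7 → ℝ) :=
  Submodule.span ℝ
    {![1, 0, 0, 0, 0, 0, 0],
      ![0, Real.sqrt 3, 0, 0, 0, Real.sqrt 5, 0],
      ![0, 0, Real.sqrt 3, 0, 0, 0, -Real.sqrt 5]}

/-- `W = span (e₅, √5e₂−√3e₆, √5e₃+√3e₇)`, in coordinates. -/
def WOct : Submodule ℝ (Fin 7 → ℝ) :=
  Submodule.span ℝ
    {![0, 0, 0, 0, 1, 0, 0],
      ![0, Real.sqrt 5, 0, 0, 0, -Real.sqrt 3, 0],
      ![0, 0, Real.sqrt 5, 0, 0, 0, Real.sqrt 3]}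

/-- The line `ℝ e₄`, in coordinates. -/
def E4line : Submodule ℝ (Fin 7 → ℝ) := Submodule.span ℝ {![0, 0, 0, 1, 0, 0, 0]}

/-- The harmonic part of `x³`. -/
def hx : P3 := X 0 ^ 3 - MvPolynomial.C (3 / 5 : ℝ) * ((X 0 ^ 2 + X 1 ^ 2 + X 2 ^ 2) * X 0)

/-- The harmonic part of `y³`. -/
def hy : P3 := X 1 ^ 3 - MvPolynomial.C (3 / 5 : ℝ) * ((X 0 ^ 2 + X 1 ^ 2 + X 2 ^ 2) * X 1)

/-- The harmonic part of `z³`. -/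
def hz : P3 := X 2 ^ 3 - MvPolynomial.C (3 / 5 : ℝ) * ((X 0 ^ 2 + X 1 ^ 2 + X 2 ^ 2) * X 2)


/-! ### The substitution action on polynomials -/

/-- The substitution action as an algebra homomorphism. -/
def sActHom (A : Matrix (Fin 3) (Fin 3) ℝ) : P3 →ₐ[ℝ] P3 :=
  aeval (fun i => ∑ j, A⁻¹ i j • (X j : P3))

theorem sActHom_X (A : Matrix (Fin 3) (Fin 3) ℝ) (i : Fin 3) :
    sActHom A (X i) = ∑ j, A⁻¹ i j • (X j : P3) := by
  simp [sActHom]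

theorem sActHom_one : sActHom 1 = AlgHom.id ℝ P3 := by
  ext i
  simp [sActHom_X, Matrix.one_apply]

theorem sActHom_mul (A B : Matrix (Fin 3) (Fin 3) ℝ) :
    sActHom (A * B) = (sActHom A).comp (sActHom B) := by
  apply MvPolynomial.algHom_ext
  intro i
  simp only [AlgHom.comp_apply, sActHom_X, Matrix.mul_inv_rev, map_sum, map_smul, Matrix.mul_apply,
    Finset.sum_smul, Finset.smul_sum, smul_smul]
  exact Finset.sum_comm

theorem sActHom_X_of_orthogonal {A : Matrix (Fin 3) (Fin 3) ℝ} (hA : A * Aᵀ = 1) (i : Fin 3) :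
    sActHom A (X i) = A 0 i • (X 0 : P3) + A 1 i • X 1 + A 2 i • X 2 := by
  rw [sActHom_X, Matrix.inv_eq_right_inv hA, Fin.sum_univ_three]
  rfl

/-- The identification of coordinates with cubic polynomials, as a linear map. -/
def iotaLin : (Fin 7 → ℝ) →ₗ[ℝ] P3 := Fintype.linearCombination ℝ eH

theorem iotaLin_apply (v : Fin 7 → ℝ) : iotaLin v = iotaH v := rfl

theorem polySet_eq (E : Submodule ℝ (Fin 7 → ℝ)) : polySet E = (E.map iotaLin : Submodule ℝ P3) :=
  rfl

theorem invUnder_iff (A : Matrix (Fin 3) (Fin 3) ℝ) (E : Submodule ℝ (Fin 7 → ℝ)) :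
    InvUnder A E ↔ (E.map iotaLin).map (sActHom A).toLinearMap = E.map iotaLin :=
  SetLike.coe_set_eq (p := (E.map iotaLin).map (sActHom A).toLinearMap) (q := E.map iotaLin)

theorem InvUnder.mul {A B : Matrix (Fin 3) (Fin 3) ℝ} {E : Submodule ℝ (Fin 7 → ℝ)}
    (hA : InvUnder A E) (hB : InvUnder B E) : InvUnder (A * B) E := by
  rw [invUnder_iff] at *
  rw [sActHom_mul, AlgHom.comp_toLinearMap, Submodule.map_comp, hB, hA]

theorem InvUnder.one (E : Submodule ℝ (Fin 7 → ℝ)) : InvUnder 1 E := by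
  rw [invUnder_iff, sActHom_one]
  exact Submodule.map_id _

/-- The rotation by a quarter turn about the `z`-axis. -/
def octQuarter : Matrix (Fin 3) (Fin 3) ℝ := !![0, -1, 0; 1, 0, 0; 0, 0, 1]

/-- The cyclic permutation of the coordinate axes. -/
def octCycle : Matrix (Fin 3) (Fin 3) ℝ := !![0, 0, 1; 1, 0, 0; 0, 1, 0]

/-- The half turn about the line `x = 0`, `y = z`. -/
def octHalf : Matrix (Fin 3) (Fin 3) ℝ := !![-1, 0, 0; 0, 0, 1; 0, 1, 0]

theorem octSet_eq : OctSet = (Submonoid.closure {octQuarter, octCycle, octHalf} :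
    Submonoid (Matrix (Fin 3) (Fin 3) ℝ)) := rfl

theorem octQuarter_orthogonal : octQuarter * octQuarterᵀ = 1 := by
  ext i j; fin_cases i <;> fin_cases j <;> simp [octQuarter, Matrix.mul_apply, Fin.sum_univ_three]

theorem octCycle_orthogonal : octCycle * octCycleᵀ = 1 := by
  ext i j; fin_cases i <;> fin_cases j <;> simp [octCycle, Matrix.mul_apply, Fin.sum_univ_three]

theorem octHalf_orthogonal : octHalf * octHalfᵀ = 1 := by
  ext i j; fin_cases i <;> fin_cases j <;> simp [octHalf, Matrix.mul_apply, Fin.sum_univ_three]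

@[simp] theorem octQuarter_X0 : sActHom octQuarter (X 0) = X 1 := by
  rw [sActHom_X_of_orthogonal octQuarter_orthogonal]; simp [octQuarter]

@[simp] theorem octQuarter_X1 : sActHom octQuarter (X 1) = -X 0 := by
  rw [sActHom_X_of_orthogonal octQuarter_orthogonal]; simp [octQuarter]

@[simp] theorem octQuarter_X2 : sActHom octQuarter (X 2) = X 2 := by
  rw [sActHom_X_of_orthogonal octQuarter_orthogonal]; simp [octQuarter]

@[simp] theorem octCycle_X0 : sActHom octCycle (X 0) = X 1 := by
  rw [sActHom_X_of_orthogonal octCycle_orthogonal]; simp [octCycle]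

@[simp] theorem octCycle_X1 : sActHom octCycle (X 1) = X 2 := by
  rw [sActHom_X_of_orthogonal octCycle_orthogonal]; simp [octCycle]

@[simp] theorem octCycle_X2 : sActHom octCycle (X 2) = X 0 := by
  rw [sActHom_X_of_orthogonal octCycle_orthogonal]; simp [octCycle]

@[simp] theorem octHalf_X0 : sActHom octHalf (X 0) = -X 0 := by
  rw [sActHom_X_of_orthogonal octHalf_orthogonal]; simp [octHalf]

@[simp] theorem octHalf_X1 : sActHom octHalf (X 1) = X 2 := by
  rw [sActHom_X_of_orthogonal octHalf_orthogonal]; simp [octHalf]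

@[simp] theorem octHalf_X2 : sActHom octHalf (X 2) = X 1 := by
  rw [sActHom_X_of_orthogonal octHalf_orthogonal]; simp [octHalf]

/-! ### A basis of cubics adapted to the octahedral group -/

/-- The cubic `x (y² - z²)`. -/
def wx : P3 := X 0 * (X 1 ^ 2 - X 2 ^ 2)

/-- The cubic `y (z² - x²)`. -/
def wy : P3 := X 1 * (X 2 ^ 2 - X 0 ^ 2)

/-- The cubic `z (x² - y²)`. -/
def wz : P3 := X 2 * (X 0 ^ 2 - X 1 ^ 2)

/-- The cubic `x y z`. -/
def xyz : P3 := X 0 * X 1 * X 2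

@[simp] theorem sActHom_C (A : Matrix (Fin 3) (Fin 3) ℝ) (r : ℝ) :
    sActHom A (MvPolynomial.C r) = MvPolynomial.C r :=
  (sActHom A).commutes r

@[simp] theorem octQuarter_hx : sActHom octQuarter hx = hy := by simp [hx, hy]; ring
@[simp] theorem octQuarter_hy : sActHom octQuarter hy = -hx := by simp [hx, hy]; ring
@[simp] theorem octQuarter_hz : sActHom octQuarter hz = hz := by simp [hz]; ring
@[simp] theorem octQuarter_xyz : sActHom octQuarter xyz = -xyz := by simp [xyz]; ring
@[simp] theorem octQuarter_wx : sActHom octQuarter wx = -wy := by simp [wx, wy]; ring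
@[simp] theorem octQuarter_wy : sActHom octQuarter wy = wx := by simp [wx, wy]; ring
@[simp] theorem octQuarter_wz : sActHom octQuarter wz = -wz := by simp [wz]; ring

@[simp] theorem octCycle_hx : sActHom octCycle hx = hy := by simp [hx, hy]; ring
@[simp] theorem octCycle_hy : sActHom octCycle hy = hz := by simp [hy, hz]; ring
@[simp] theorem octCycle_hz : sActHom octCycle hz = hx := by simp [hx, hz]; ring
@[simp] theorem octCycle_xyz : sActHom octCycle xyz = xyz := by simp [xyz]; ring
@[simp] theorem octCycle_wx : sActHom octCycle wx = wy := by simp [wx, wy]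
@[simp] theorem octCycle_wy : sActHom octCycle wy = wz := by simp [wy, wz]
@[simp] theorem octCycle_wz : sActHom octCycle wz = wx := by simp [wx, wz]

@[simp] theorem octHalf_hx : sActHom octHalf hx = -hx := by simp [hx]; ring
@[simp] theorem octHalf_hy : sActHom octHalf hy = hz := by simp [hy, hz]; ring
@[simp] theorem octHalf_hz : sActHom octHalf hz = hy := by simp [hy, hz]; ring
@[simp] theorem octHalf_xyz : sActHom octHalf xyz = -xyz := by simp [xyz]; ring
@[simp] theorem octHalf_wx : sActHom octHalf wx = wx := by simp [wx]; ring
@[simp] theorem octHalf_wy : sActHom octHalf wy = -wz := by simp [wy, wz]; ring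
@[simp] theorem octHalf_wz : sActHom octHalf wz = -wy := by simp [wy, wz]; ring

theorem sqrt_six_eq : √6 = √2 * √3 := by rw [← Real.sqrt_mul (by norm_num)]; norm_num

theorem sqrt_ten_eq : √10 = √2 * √5 := by rw [← Real.sqrt_mul (by norm_num)]; norm_num

theorem sqrt_fifteen_eq : √15 = √3 * √5 := by rw [← Real.sqrt_mul (by norm_num)]; norm_num

theorem iotaH_eq_adapted (v : Fin 7 → ℝ) :
    iotaH v = v 0 • hx + (√2 / 4 * (√5 * v 6 - √3 * v 2)) • hy
      + (-(√2 / 4) * (√3 * v 1 + √5 * v 5)) • hz + (2 * √15 / 5 * v 3) • xyz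
      + (√15 / 5 * v 4) • wx - (√2 / 4 * (√3 * v 2 + √5 * v 6 * (3 / 5))) • wy
      + (√2 / 4 * (√3 * v 1 - √5 * v 5 * (3 / 5))) • wz := by
  apply MvPolynomial.funext
  intro r
  simp [iotaH, eH, Fin.sum_univ_succ, hx, hy, hz, wx, wy, wz, xyz, sqrt_six_eq, sqrt_ten_eq,
    sqrt_fifteen_eq, smul_eval]
  ring

theorem iotaLin_injective : Function.Injective iotaLin := by
  rw [injective_iff_map_eq_zero]
  intro v hv
  have key : ∀ x y z : ℝ, eval ![x, y, z] (iotaH v) = 0 := by simp [← iotaLin_apply, hv]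
  simp only [iotaH_eq_adapted, hx, hy, hz, wx, wy, wz, xyz, smul_eval, map_add, map_sub, map_mul,
    map_pow, eval_X, eval_C, Matrix.cons_val] at key
  have h2 : √2 ≠ 0 := by positivity
  have h3 : √3 ≠ 0 := by positivity
  have h5 : √5 ≠ 0 := by positivity
  have h15 : √15 ≠ 0 := by positivity
  have hx1 := key 1 0 0
  have hy1 := key 0 1 0
  have hz1 := key 0 0 1
  have hyz := key 0 1 1
  have hxyz := key 1 1 1
  have hxy := key 1 1 0
  have hxy' := key 1 (-1) 0
  have e0 : v 0 = 0 := by linear_combination 5 / 2 * hx1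
  have e4 : √15 * v 4 = 0 := by linear_combination 5 / 2 * (hxy + hxy' + hx1)
  have e3 : √15 * v 3 = 0 := by linear_combination 5 / 2 * hxyz + 5 * (hx1 + hy1 + hz1)
  have e1 : √2 * √3 * v 1 = 0 := by
    linear_combination -15 / 4 * hz1 + 5 / 2 * ((hxy' - hxy - 2 * hy1 - hz1) / 2 - hyz)
  have e2 : √2 * √3 * v 2 = 0 := by
    linear_combination -15 / 4 * hy1 - 5 / 2 * ((hxy' - hxy - hy1) / 2)
  have e5 : √2 * √5 * v 5 = 0 := by
    linear_combination -25 / 4 * hz1 - 5 / 2 * ((hxy' - hxy - 2 * hy1 - hz1) / 2 - hyz)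
  have e6 : √2 * √5 * v 6 = 0 := by
    linear_combination 25 / 4 * hy1 - 5 / 2 * ((hxy' - hxy - hy1) / 2)
  simp only [mul_eq_zero, h2, h3, h5, h15, false_or] at e1 e2 e3 e4 e5 e6
  ext i
  fin_cases i <;> assumption

theorem span_triple_smul {V : Type*} [AddCommGroup V] [Module ℝ V] {a b c : ℝ} (ha : a ≠ 0)
    (hb : b ≠ 0) (hc : c ≠ 0) (u v w : V) :
    Submodule.span ℝ {a • u, b • v, c • w} = Submodule.span ℝ {u, v, w} := by
  simp only [Submodule.span_insert, Submodule.span_singleton_smul_eq ha.isUnit,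
    Submodule.span_singleton_smul_eq hb.isUnit, Submodule.span_singleton_smul_eq hc.isUnit]

theorem map_iotaLin_AOct : AOct.map iotaLin = Submodule.span ℝ {hx, hy, hz} := by
  have e1 : iotaLin ![1, 0, 0, 0, 0, 0, 0] = (1 : ℝ) • hx := by
    simp [iotaLin_apply, iotaH_eq_adapted]
  have e2 : iotaLin ![0, √3, 0, 0, 0, √5, 0] = (-(2 * √2)) • hz := by
    simp only [iotaLin_apply, iotaH_eq_adapted, Matrix.cons_val]
    ring_nf
    simp
    ring_nf
    module
  have e3 : iotaLin ![0, 0, √3, 0, 0, 0, -√5] = (-(2 * √2)) • hy := by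
    simp only [iotaLin_apply, iotaH_eq_adapted, Matrix.cons_val]
    ring_nf
    simp
    ring_nf
    module
  rw [AOct, Submodule.map_span, Set.image_insert_eq, Set.image_insert_eq, Set.image_singleton,
    e1, e2, e3, span_triple_smul (by simp) (by simp) (by simp), Set.pair_comm]

theorem map_iotaLin_WOct : WOct.map iotaLin = Submodule.span ℝ {wx, wy, wz} := by
  have e1 : iotaLin ![0, 0, 0, 0, 1, 0, 0] = (√15 / 5) • wx := by
    simp [iotaLin_apply, iotaH_eq_adapted]
  have e2 : iotaLin ![0, √5, 0, 0, 0, -√3, 0] = (2 * √2 * √15 / 5) • wz := by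
    simp only [iotaLin_apply, iotaH_eq_adapted, Matrix.cons_val, sqrt_fifteen_eq]
    module
  have e3 : iotaLin ![0, 0, √5, 0, 0, 0, √3] = (-(2 * √2 * √15 / 5)) • wy := by
    simp only [iotaLin_apply, iotaH_eq_adapted, Matrix.cons_val, sqrt_fifteen_eq]
    module
  rw [WOct, Submodule.map_span, Set.image_insert_eq, Set.image_insert_eq, Set.image_singleton,
    e1, e2, e3, span_triple_smul (by simp) (by simp) (by simp), Set.pair_comm]

theorem map_iotaLin_E4line : E4line.map iotaLin = Submodule.span ℝ {xyz} := by
  have e1 : iotaLin ![0, 0, 0, 1, 0, 0, 0] = (2 * √15 / 5) • xyz := by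
    simp [iotaLin_apply, iotaH_eq_adapted]
  rw [E4line, Submodule.map_span, Set.image_singleton, e1,
    Submodule.span_singleton_smul_eq (by simp)]

theorem mem_AOct_iff {v : Fin 7 → ℝ} :
    v ∈ AOct ↔ v 3 = 0 ∧ v 4 = 0 ∧ √5 * v 1 = √3 * v 5 ∧ √5 * v 2 = -√3 * v 6 := by
  have h3 : √3 * √3 = 3 := Real.mul_self_sqrt (by norm_num)
  have h5 : √5 * √5 = 5 := Real.mul_self_sqrt (by norm_num)
  rw [AOct, Submodule.mem_span_triple]
  constructor
  · rintro ⟨a, b, c, rfl⟩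
    simp
    constructor <;> ring
  · rintro ⟨e3, e4, e15, e26⟩
    refine ⟨v 0, (√3 * v 1 + √5 * v 5) / 8, (√3 * v 2 - √5 * v 6) / 8, ?_⟩
    ext i
    fin_cases i <;> simp [e3, e4]
    · linear_combination v 1 / 8 * h3 - √5 / 8 * e15 + v 1 / 8 * h5
    · linear_combination v 2 / 8 * h3 - √5 / 8 * e26 + v 2 / 8 * h5
    · linear_combination v 5 / 8 * h5 + √3 / 8 * e15 + v 5 / 8 * h3
    · linear_combination v 6 / 8 * h5 - √3 / 8 * e26 + v 6 / 8 * h3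

theorem mem_WOct_iff {v : Fin 7 → ℝ} :
    v ∈ WOct ↔ v 0 = 0 ∧ v 3 = 0 ∧ √3 * v 1 = -√5 * v 5 ∧ √3 * v 2 = √5 * v 6 := by
  have h3 : √3 * √3 = 3 := Real.mul_self_sqrt (by norm_num)
  have h5 : √5 * √5 = 5 := Real.mul_self_sqrt (by norm_num)
  rw [WOct, Submodule.mem_span_triple]
  constructor
  · rintro ⟨a, b, c, rfl⟩
    simp
    constructor <;> ring
  · rintro ⟨e0, e3, e15, e26⟩
    refine ⟨v 4, (√5 * v 1 - √3 * v 5) / 8, (√5 * v 2 + √3 * v 6) / 8, ?_⟩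
    ext i
    fin_cases i <;> simp [e0, e3]
    · linear_combination v 1 / 8 * h3 - √3 / 8 * e15 + v 1 / 8 * h5
    · linear_combination v 2 / 8 * h3 - √3 / 8 * e26 + v 2 / 8 * h5
    · linear_combination v 5 / 8 * h5 - √5 / 8 * e15 + v 5 / 8 * h3
    · linear_combination v 6 / 8 * h5 + √5 / 8 * e26 + v 6 / 8 * h3

theorem mem_E4line_iff {v : Fin 7 → ℝ} : v ∈ E4line ↔ ∀ i, i ≠ 3 → v i = 0 := by
  rw [E4line, Submodule.mem_span_singleton]
  constructor
  · rintro ⟨a, rfl⟩ i hi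
    fin_cases i <;> simp at hi ⊢
  · intro h
    refine ⟨v 3, ?_⟩
    ext i
    fin_cases i <;> simp [h]

theorem AOct_sup : AOct ⊔ (E4line ⊔ WOct) = ⊤ := by
  have h3 : √3 * √3 = 3 := Real.mul_self_sqrt (by norm_num)
  have h5 : √5 * √5 = 5 := Real.mul_self_sqrt (by norm_num)
  refine eq_top_iff.2 fun v _ => ?_
  have hv : v = ![v 0, (√3 * v 1 + √5 * v 5) / 8 * √3, (√3 * v 2 - √5 * v 6) / 8 * √3, 0, 0,
        (√3 * v 1 + √5 * v 5) / 8 * √5, -((√3 * v 2 - √5 * v 6) / 8 * √5)]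
      + (![0, 0, 0, v 3, 0, 0, 0] + ![0, (√5 * v 1 - √3 * v 5) / 8 * √5,
        (√5 * v 2 + √3 * v 6) / 8 * √5, 0, v 4, -((√5 * v 1 - √3 * v 5) / 8 * √3),
        (√5 * v 2 + √3 * v 6) / 8 * √3]) := by
    ext i
    fin_cases i <;> simp
    · linear_combination -v 1 / 8 * h3 - v 1 / 8 * h5
    · linear_combination -v 2 / 8 * h3 - v 2 / 8 * h5
    · linear_combination -v 5 / 8 * h3 - v 5 / 8 * h5
    · linear_combination -v 6 / 8 * h3 - v 6 / 8 * h5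
  rw [hv]
  refine Submodule.add_mem_sup (mem_AOct_iff.2 ?_) (Submodule.add_mem_sup (mem_E4line_iff.2 ?_)
    (mem_WOct_iff.2 ?_))
  · simp; constructor <;> ring
  · intro i hi
    fin_cases i <;> simp at hi ⊢
  · simp; constructor <;> ring

theorem E4line_inf : E4line ⊓ WOct = ⊥ := by
  refine eq_bot_iff.2 fun v hv => ?_
  have h4 := mem_E4line_iff.1 hv.1
  ext i
  by_cases hi : i = 3
  · rw [hi]
    exact (mem_WOct_iff.1 hv.2).2.1
  · exact h4 i hi

theorem AOct_inf : AOct ⊓ (E4line ⊔ WOct) = ⊥ := by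
  have h3 : √3 * √3 = 3 := Real.mul_self_sqrt (by norm_num)
  have h5 : √5 * √5 = 5 := Real.mul_self_sqrt (by norm_num)
  refine eq_bot_iff.2 fun v hv => ?_
  obtain ⟨hA, hB⟩ := hv
  obtain ⟨a3, a4, a15, a26⟩ := mem_AOct_iff.1 hA
  obtain ⟨e, he, w, hw, rfl⟩ := Submodule.mem_sup.1 hB
  rw [mem_E4line_iff] at he
  obtain ⟨w0, w3, w15, w26⟩ := mem_WOct_iff.1 hw
  simp [he] at a3 a4 a15 a26
  have w1 : w 1 = 0 := by
    linear_combination √5 / 8 * a15 + √3 / 8 * w15 - w 1 / 8 * h3 - w 1 / 8 * h5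
  have w2 : w 2 = 0 := by
    linear_combination √5 / 8 * a26 + √3 / 8 * w26 - w 2 / 8 * h3 - w 2 / 8 * h5
  have w5 : w 5 = 0 := by
    linear_combination -√3 / 8 * a15 + √5 / 8 * w15 - w 5 / 8 * h3 - w 5 / 8 * h5
  have w6 : w 6 = 0 := by
    linear_combination √3 / 8 * a26 - √5 / 8 * w26 - w 6 / 8 * h3 - w 6 / 8 * h5
  ext i
  fin_cases i <;> simp [*]
  linarith

theorem isAssoc_AOct : IsAssocSubspace AOct := by
  have h3 : √3 * √3 = 3 := Real.mul_self_sqrt (by norm_num)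
  have h5 : √5 * √5 = 5 := Real.mul_self_sqrt (by norm_num)
  have h8 : √8 * √8 = 8 := Real.mul_self_sqrt (by norm_num)
  have h8' : √8 ≠ 0 := by positivity
  refine ⟨(1 : ℝ) • ![1, 0, 0, 0, 0, 0, 0], (√8)⁻¹ • ![0, √3, 0, 0, 0, √5, 0],
    (√8)⁻¹ • ![0, 0, √3, 0, 0, 0, -√5], ?_, ?_, ?_, ?_, ?_, ?_, ?_, ?_, ?_,
    span_triple_smul (by simp) (by simp) (by simp) _ _ _, Or.inl ?_⟩
  · simp [mem_AOct_iff]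
  · simp [mem_AOct_iff]; ring
  · simp [mem_AOct_iff]; ring
  · simp [dot7, Fin.sum_univ_succ]
  · simp [dot7, Fin.sum_univ_succ]
    field_simp
    linarith
  · simp [dot7, Fin.sum_univ_succ]
    field_simp
    linarith
  · simp [dot7, Fin.sum_univ_succ]
  · simp [dot7, Fin.sum_univ_succ]
  · simp [dot7, Fin.sum_univ_succ]
  · simp [phi0, triD, Matrix.det_fin_three]
    field_simp
    linarith

theorem phi0_eq_zero_of_mem_WOct {u v w : Fin 7 → ℝ} (hu : u ∈ WOct) (hv : v ∈ WOct)
    (hw : w ∈ WOct) : phi0 u v w = 0 := by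
  rw [WOct, Submodule.mem_span_triple] at hu hv hw
  obtain ⟨a, b, c, rfl⟩ := hu
  obtain ⟨a', b', c', rfl⟩ := hv
  obtain ⟨a'', b'', c'', rfl⟩ := hw
  simp [phi0, triD, Matrix.det_fin_three]
  ring

theorem not_isAssoc_WOct : ¬ IsAssocSubspace WOct := by
  rintro ⟨u, v, w, hu, hv, hw, -, -, -, -, -, -, -, h⟩
  rw [phi0_eq_zero_of_mem_WOct hu hv hw] at h
  norm_num at h

/-! ### Invariance under the octahedral group -/

theorem invUnder_of_generators {E : Submodule ℝ (Fin 7 → ℝ)}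
    (h : ∀ A ∈ ({octQuarter, octCycle, octHalf} : Set (Matrix (Fin 3) (Fin 3) ℝ)), InvUnder A E)
    {A : Matrix (Fin 3) (Fin 3) ℝ} (hA : A ∈ OctSet) : InvUnder A E := by
  rw [octSet_eq, SetLike.mem_coe] at hA
  induction hA using Submonoid.closure_induction with
  | mem x hx => exact h x hx
  | one => exact InvUnder.one E
  | mul x y _ _ hx hy => exact hx.mul hy

theorem invUnder_AOct {A : Matrix (Fin 3) (Fin 3) ℝ} (hA : A ∈ OctSet) : InvUnder A AOct := by
  refine invUnder_of_generators ?_ hA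
  rintro g (rfl | rfl | rfl) <;>
  · rw [invUnder_iff, map_iotaLin_AOct, Submodule.map_span]
    simp only [Set.image_insert_eq, Set.image_singleton, AlgHom.toLinearMap_apply, octQuarter_hx,
      octQuarter_hy, octQuarter_hz, octCycle_hx, octCycle_hy, octCycle_hz, octHalf_hx, octHalf_hy,
      octHalf_hz, Submodule.span_insert, ← Set.neg_singleton, Submodule.span_neg]
    simp only [sup_comm, sup_left_comm]

theorem invUnder_WOct {A : Matrix (Fin 3) (Fin 3) ℝ} (hA : A ∈ OctSet) : InvUnder A WOct := by
  refine invUnder_of_generators ?_ hA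
  rintro g (rfl | rfl | rfl) <;>
  · rw [invUnder_iff, map_iotaLin_WOct, Submodule.map_span]
    simp only [Set.image_insert_eq, Set.image_singleton, AlgHom.toLinearMap_apply, octQuarter_wx,
      octQuarter_wy, octQuarter_wz, octCycle_wx, octCycle_wy, octCycle_wz, octHalf_wx, octHalf_wy,
      octHalf_wz, Submodule.span_insert, ← Set.neg_singleton, Submodule.span_neg]
    simp only [sup_comm, sup_left_comm]

theorem invUnder_E4line {A : Matrix (Fin 3) (Fin 3) ℝ} (hA : A ∈ OctSet) :
    InvUnder A E4line := by
  refine invUnder_of_generators ?_ hA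
  rintro g (rfl | rfl | rfl) <;>
  · rw [invUnder_iff, map_iotaLin_E4line, Submodule.map_span]
    simp only [Set.image_singleton, AlgHom.toLinearMap_apply, octQuarter_xyz, octCycle_xyz,
      octHalf_xyz, ← Set.neg_singleton, Submodule.span_neg]

theorem finrank_span_triple_le {V : Type*} [AddCommGroup V] [Module ℝ V] (u v w : V) :
    Module.finrank ℝ (Submodule.span ℝ {u, v, w}) ≤ 3 := by
  classical
  have h := finrank_span_finset_le_card (R := ℝ) ({u, v, w} : Finset V)
  simp only [Finset.coe_insert, Finset.coe_singleton] at h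
  exact h.trans Finset.card_le_three

theorem finrank_AOct_WOct : Module.finrank ℝ AOct = 3 ∧ Module.finrank ℝ WOct = 3 := by
  have h₁ := Submodule.finrank_sup_add_finrank_inf_eq AOct (E4line ⊔ WOct)
  have h₂ := Submodule.finrank_sup_add_finrank_inf_eq E4line WOct
  rw [AOct_sup, AOct_inf, finrank_top, finrank_bot, Module.finrank_fin_fun] at h₁
  rw [E4line_inf, finrank_bot] at h₂
  have hA : Module.finrank ℝ AOct ≤ 3 := finrank_span_triple_le _ _ _
  have hW : Module.finrank ℝ WOct ≤ 3 := finrank_span_triple_le _ _ _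
  have hE : Module.finrank ℝ E4line ≤ 1 := (finrank_span_le_card _).trans (by simp)
  omega

/-- A submodule stable under the generators of the octahedral group that contains a polynomial
with a nonzero `hz`-coordinate contains all of `hx, hy, hz`; likewise for `wz`. -/
theorem span_le_of_mem_adapted {M : Submodule ℝ P3} (hq : ∀ p ∈ M, sActHom octQuarter p ∈ M)
    (hc : ∀ p ∈ M, sActHom octCycle p ∈ M) (hh : ∀ p ∈ M, sActHom octHalf p ∈ M)
    {a₁ a₂ a₃ d b₁ b₂ b₃ : ℝ}
    (hp : a₁ • hx + a₂ • hy + a₃ • hz + d • xyz + b₁ • wx + b₂ • wy + b₃ • wz ∈ M) :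
    (a₃ ≠ 0 → Submodule.span ℝ {hx, hy, hz} ≤ M) ∧
      (b₃ ≠ 0 → Submodule.span ℝ {wx, wy, wz} ≤ M) := by
  have e₁ := M.add_mem hp (hq _ (hq _ hp))
  have e₂ := M.add_mem e₁ (hq _ e₁)
  have e₃ := M.sub_mem e₁ (hq _ e₁)
  have e₄ := M.sub_mem e₃ (hh _ (hq _ (hq _ (hh _ e₃))))
  simp only [map_add, map_sub, map_smul, map_neg, smul_neg, neg_neg, octQuarter_hx, octQuarter_hy,
    octQuarter_hz, octQuarter_wx, octQuarter_wy, octQuarter_wz, octQuarter_xyz, octHalf_hx,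
    octHalf_hy, octHalf_hz, octHalf_wx, octHalf_wy, octHalf_wz, octHalf_xyz] at e₂ e₄
  constructor
  · intro ha
    have h₃ : hz ∈ M := by
      convert M.smul_mem (4 * a₃)⁻¹ e₂ using 1
      match_scalars <;> field_simp <;> ring
    have h₁ : hx ∈ M := by simpa using hc _ h₃
    have h₂ : hy ∈ M := by simpa using hc _ h₁
    simp [Submodule.span_le, Set.insert_subset_iff, h₁, h₂, h₃]
  · intro hb
    have h₃ : wz ∈ M := by
      convert M.smul_mem (8 * b₃)⁻¹ e₄ using 1
      match_scalars <;> field_simp <;> ring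
    have h₁ : wx ∈ M := by simpa using hc _ h₃
    have h₂ : wy ∈ M := by simpa using hc _ h₁
    simp [Submodule.span_le, Set.insert_subset_iff, h₁, h₂, h₃]

theorem eq_AOct_or_eq_WOct {E : Submodule ℝ (Fin 7 → ℝ)} (hE : Module.finrank ℝ E = 3)
    (hinv : ∀ A ∈ OctSet, InvUnder A E) : E = AOct ∨ E = WOct := by
  have hmem : ∀ A ∈ OctSet, ∀ p ∈ E.map iotaLin, sActHom A p ∈ E.map iotaLin := fun A hA p hp =>
    ((invUnder_iff A E).1 (hinv A hA)).le (Submodule.mem_map_of_mem hp)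
  rw [octSet_eq] at hmem
  have hq := hmem octQuarter (Submonoid.subset_closure (by simp))
  have hc := hmem octCycle (Submonoid.subset_closure (by simp))
  have hh := hmem octHalf (Submonoid.subset_closure (by simp))
  obtain ⟨fA, fW⟩ := finrank_AOct_WOct
  by_cases hA : Submodule.span ℝ {hx, hy, hz} ≤ E.map iotaLin
  · rw [← map_iotaLin_AOct, Submodule.map_le_map_iff_of_injective iotaLin_injective] at hA
    exact Or.inl (Submodule.eq_of_le_of_finrank_eq hA (by rw [fA, hE])).symm
  by_cases hW : Submodule.span ℝ {wx, wy, wz} ≤ E.map iotaLin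
  · rw [← map_iotaLin_WOct, Submodule.map_le_map_iff_of_injective iotaLin_injective] at hW
    exact Or.inr (Submodule.eq_of_le_of_finrank_eq hW (by rw [fW, hE])).symm
  exfalso
  have hle : E ≤ E4line := by
    rw [← Submodule.map_le_map_iff_of_injective iotaLin_injective, map_iotaLin_E4line]
    rintro _ ⟨v, hv, rfl⟩
    have hp : iotaLin v ∈ E.map iotaLin := Submodule.mem_map_of_mem hv
    rw [iotaLin_apply, iotaH_eq_adapted, sub_eq_add_neg, ← neg_smul] at hp ⊢
    have hp₁ := hc _ hp
    have hp₂ := hc _ hp₁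
    simp only [map_add, map_smul, octCycle_hx, octCycle_hy, octCycle_hz, octCycle_wx, octCycle_wy,
      octCycle_wz, octCycle_xyz] at hp₁ hp₂
    generalize v 0 = a₁ at *
    generalize √2 / 4 * (√5 * v 6 - √3 * v 2) = a₂ at *
    generalize -(√2 / 4) * (√3 * v 1 + √5 * v 5) = a₃ at *
    generalize √15 / 5 * v 4 = b₁ at *
    generalize -(√2 / 4 * (√3 * v 2 + √5 * v 6 * (3 / 5))) = b₂ at *
    generalize √2 / 4 * (√3 * v 1 - √5 * v 5 * (3 / 5)) = b₃ at *
    generalize 2 * √15 / 5 * v 3 = d at *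
    have k₃ := span_le_of_mem_adapted hq hc hh hp
    have k₂ := span_le_of_mem_adapted hq hc hh (a₁ := a₃) (a₂ := a₁) (a₃ := a₂) (d := d)
      (b₁ := b₃) (b₂ := b₁) (b₃ := b₂) (by convert hp₁ using 1; module)
    have k₁ := span_le_of_mem_adapted hq hc hh (a₁ := a₂) (a₂ := a₃) (a₃ := a₁) (d := d)
      (b₁ := b₂) (b₂ := b₃) (b₃ := b₁) (by convert hp₂ using 1; module)
    simp only [hA, hW, imp_false, not_not] at k₁ k₂ k₃
    simp only [k₁, k₂, k₃, zero_smul, zero_add, add_zero]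
    exact Submodule.smul_mem _ _ (Submodule.mem_span_singleton_self _)
  have h₁ := Submodule.finrank_mono hle
  have h₂ : Module.finrank ℝ E4line ≤ 1 := (finrank_span_le_card _).trans (by simp)
  omega

/-! ### The octahedral group as a symmetric group -/

/-- The four long diagonals of the cube, as the columns of a matrix. -/
def cubeDiag : Matrix (Fin 3) (Fin 4) ℤ := !![1, 1, -1, -1; 1, -1, 1, -1; 1, -1, -1, 1]

/-- Four times the integral matrix of the rotation of the cube inducing the permutation `σ` of its
long diagonals. -/
def cubeMat (σ : Equiv.Perm (Fin 4)) : Matrix (Fin 3) (Fin 3) ℤ :=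
  (Equiv.Perm.sign σ : ℤ) • (cubeDiag.submatrix id σ * cubeDiagᵀ)

theorem cubeDiag_gram :
    cubeDiagᵀ * cubeDiag = (4 : ℤ) • (1 : Matrix (Fin 4) (Fin 4) ℤ) - Matrix.of fun _ _ => 1 := by
  decide

theorem cubeMat_mul (σ τ : Equiv.Perm (Fin 4)) :
    cubeMat σ * cubeMat τ = (4 : ℤ) • cubeMat (σ * τ) := by
  have hJ : cubeDiag.submatrix id σ * (Matrix.of fun _ _ => 1 : Matrix (Fin 4) (Fin 4) ℤ) = 0 := by
    ext a b
    simp only [Matrix.mul_apply, Matrix.submatrix_apply, id, Matrix.of_apply, mul_one]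
    rw [Equiv.sum_comp σ fun i => cubeDiag a i, Matrix.zero_apply]
    clear b
    revert a
    decide
  have hG : cubeDiagᵀ * cubeDiag.submatrix id τ =
      (4 : ℤ) • (1 : Matrix (Fin 4) (Fin 4) ℤ).submatrix id τ - Matrix.of fun _ _ => 1 :=
    congrArg (fun M => M.submatrix id τ) cubeDiag_gram
  have hP : cubeDiag.submatrix id σ * (1 : Matrix (Fin 4) (Fin 4) ℤ).submatrix id τ =
      cubeDiag.submatrix id (σ * τ) := by
    ext a b
    simp [Matrix.mul_apply, Matrix.one_apply]
  have hD : cubeDiag.submatrix id σ * cubeDiagᵀ * (cubeDiag.submatrix id τ * cubeDiagᵀ) =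
      (4 : ℤ) • (cubeDiag.submatrix id (σ * τ) * cubeDiagᵀ) := by
    rw [Matrix.mul_assoc, ← Matrix.mul_assoc cubeDiagᵀ, hG, ← Matrix.mul_assoc, Matrix.mul_sub,
      Matrix.mul_smul, hP, hJ, sub_zero, Matrix.smul_mul]
  rw [cubeMat, cubeMat, cubeMat, Matrix.smul_mul, Matrix.mul_smul, hD, map_mul, Units.val_mul,
    smul_smul, smul_smul, smul_smul]
  congr 1
  ring

theorem cubeMat_injective : Function.Injective cubeMat := by
  decide +kernel

/-- The rotation of the cube inducing the permutation `σ` of its long diagonals. -/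
def octHom : Equiv.Perm (Fin 4) →* Matrix (Fin 3) (Fin 3) ℝ where
  toFun σ := (4⁻¹ : ℝ) • (cubeMat σ).map (Int.castRingHom ℝ)
  map_one' := by
    have h : cubeMat 1 = (4 : ℤ) • 1 := by decide
    ext i j
    have hij := congrFun (congrFun h i) j
    rw [Matrix.smul_apply] at hij
    change 4⁻¹ * ((cubeMat 1 i j : ℤ) : ℝ) = _
    rw [hij]
    obtain rfl | e := eq_or_ne i j
    · simp
    · simp [e]
  map_mul' σ τ := by
    rw [Matrix.smul_mul, Matrix.mul_smul, ← Matrix.map_mul, cubeMat_mul]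
    ext i j
    simp [Matrix.smul_apply, -zsmul_eq_mul]

theorem octHom_apply (σ : Equiv.Perm (Fin 4)) (i j : Fin 3) :
    octHom σ i j = 4⁻¹ * (cubeMat σ i j : ℝ) := rfl

theorem octHom_injective : Function.Injective octHom := by
  intro σ τ h
  apply cubeMat_injective
  ext i j
  have hij := congrFun (congrFun h i) j
  rw [octHom_apply, octHom_apply] at hij
  exact_mod_cast mul_left_cancel₀ (by norm_num) hij

theorem octHom_eq_of_cubeMat {σ : Equiv.Perm (Fin 4)} {M : Matrix (Fin 3) (Fin 3) ℤ}
    (h : cubeMat σ = (4 : ℤ) • M) : octHom σ = M.map (Int.castRingHom ℝ) := by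
  ext i j
  simp [octHom_apply, h]

theorem octHom_quarter : octHom c[0, 1, 3, 2] = octQuarter := by
  rw [octHom_eq_of_cubeMat (M := !![0, -1, 0; 1, 0, 0; 0, 0, 1]) (by decide +kernel)]
  ext i j
  fin_cases i <;> fin_cases j <;> simp [octQuarter]

theorem octHom_cycle : octHom c[1, 2, 3] = octCycle := by
  rw [octHom_eq_of_cubeMat (M := !![0, 0, 1; 1, 0, 0; 0, 1, 0]) (by decide +kernel)]
  ext i j
  fin_cases i <;> fin_cases j <;> simp [octCycle]

theorem octHom_half : octHom c[0, 1] = octHalf := by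
  rw [octHom_eq_of_cubeMat (M := !![-1, 0, 0; 0, 0, 1; 0, 1, 0]) (by decide +kernel)]
  ext i j
  fin_cases i <;> fin_cases j <;> simp [octHalf]

theorem exists_word (σ : Equiv.Perm (Fin 4)) : ∃ i j k : Fin 4,
    σ = (c[1, 2, 3] : Equiv.Perm (Fin 4)) ^ (i : ℕ) * c[0, 1, 3, 2] ^ (j : ℕ) *
      (c[0, 1] * c[0, 1, 3, 2] ^ 2) ^ (k : ℕ) := by
  revert σ
  decide +kernel

theorem range_octHom : Set.range octHom = OctSet := by
  rw [octSet_eq, ← MonoidHom.coe_mrange, SetLike.coe_set_eq]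
  refine le_antisymm ?_ (Submonoid.closure_le.2 ?_)
  · rintro _ ⟨σ, rfl⟩
    obtain ⟨i, j, k, rfl⟩ := exists_word σ
    simp only [map_mul, map_pow, octHom_quarter, octHom_cycle, octHom_half]
    have hq := Submonoid.subset_closure (s := {octQuarter, octCycle, octHalf}) (Set.mem_insert _ _)
    have hc : octCycle ∈ Submonoid.closure {octQuarter, octCycle, octHalf} :=
      Submonoid.subset_closure (by simp)
    have hh : octHalf ∈ Submonoid.closure {octQuarter, octCycle, octHalf} :=
      Submonoid.subset_closure (by simp)
    exact mul_mem (mul_mem (pow_mem hc _) (pow_mem hq _)) (pow_mem (mul_mem hh (pow_mem hq _)) _)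
  · rintro _ (rfl | rfl | rfl)
    · exact ⟨_, octHom_quarter⟩
    · exact ⟨_, octHom_cycle⟩
    · exact ⟨_, octHom_half⟩

theorem exists_cubeMat_of_det_eq_one (π : Fin 3 → Fin 3) (s : Fin 3 → ℤˣ)
    (h : (Matrix.of fun i j => if i = π j then (s j : ℤ) else 0).det = 1) :
    ∃ σ, cubeMat σ = (4 : ℤ) • Matrix.of fun i j => if i = π j then (s j : ℤ) else 0 := by
  revert π s
  simp only [Matrix.det_fin_three]
  decide +kernel

/-! ### The stabiliser of `A_Oct` -/

theorem mem_SO3_of_mem_OctSet {A : Matrix (Fin 3) (Fin 3) ℝ} (hA : A ∈ OctSet) : A ∈ SO3 := by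
  rw [octSet_eq, SetLike.mem_coe] at hA
  induction hA using Submonoid.closure_induction with
  | mem x hx =>
    rcases hx with rfl | rfl | rfl
    · exact ⟨octQuarter_orthogonal, by simp [octQuarter, Matrix.det_fin_three]⟩
    · exact ⟨octCycle_orthogonal, by simp [octCycle, Matrix.det_fin_three]⟩
    · exact ⟨octHalf_orthogonal, by simp [octHalf, Matrix.det_fin_three]⟩
  | one => exact ⟨by simp, by simp⟩
  | mul x y _ _ hx hy =>
    refine ⟨?_, by rw [Matrix.det_mul, hx.2, hy.2, one_mul]⟩
    rw [Matrix.transpose_mul, Matrix.mul_assoc, ← Matrix.mul_assoc y, hy.1, Matrix.one_mul, hx.1]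

/-- The harmonic part of the cube of the linear form `c₀ x + c₁ y + c₂ z`, for a unit vector `c`. -/
def hCube (c : Fin 3 → ℝ) : P3 :=
  (c 0 • X 0 + c 1 • X 1 + c 2 • X 2) ^ 3 - MvPolynomial.C (3 / 5 : ℝ) *
    ((X 0 ^ 2 + X 1 ^ 2 + X 2 ^ 2) * (c 0 • X 0 + c 1 • X 1 + c 2 • X 2))

theorem sActHom_radius {A : Matrix (Fin 3) (Fin 3) ℝ} (hA : A * Aᵀ = 1) :
    sActHom A (X 0 ^ 2 + X 1 ^ 2 + X 2 ^ 2) = X 0 ^ 2 + X 1 ^ 2 + X 2 ^ 2 := by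
  have h : ∀ i j, A i 0 * A j 0 + A i 1 * A j 1 + A i 2 * A j 2 =
      (1 : Matrix (Fin 3) (Fin 3) ℝ) i j := fun i j => by
    rw [← hA, Matrix.mul_apply, Fin.sum_univ_three]
    rfl
  have h00 := h 0 0
  have h11 := h 1 1
  have h22 := h 2 2
  have h01 := h 0 1
  have h02 := h 0 2
  have h12 := h 1 2
  simp at h00 h11 h22 h01 h02 h12
  apply MvPolynomial.funext
  intro r
  simp [sActHom_X_of_orthogonal hA, smul_eval]
  linear_combination r 0 ^ 2 * h00 + r 1 ^ 2 * h11 + r 2 ^ 2 * h22 + 2 * r 0 * r 1 * h01 +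
    2 * r 0 * r 2 * h02 + 2 * r 1 * r 2 * h12

theorem sActHom_hCube {A : Matrix (Fin 3) (Fin 3) ℝ} (hA : A * Aᵀ = 1) :
    sActHom A hx = hCube (Aᵀ 0) ∧ sActHom A hy = hCube (Aᵀ 1) ∧ sActHom A hz = hCube (Aᵀ 2) := by
  refine ⟨?_, ?_, ?_⟩ <;>
  · simp only [hx, hy, hz, hCube, map_sub, map_mul, sActHom_radius hA, sActHom_C, map_pow,
      Matrix.transpose_apply]
    rw [sActHom_X_of_orthogonal hA]

theorem eq_single_of_hCube_mem {c : Fin 3 → ℝ} (hc : c 0 ^ 2 + c 1 ^ 2 + c 2 ^ 2 = 1)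
    (h : hCube c ∈ Submodule.span ℝ {hx, hy, hz}) :
    ∃ (k : Fin 3) (s : ℤˣ), ∀ i, c i = if i = k then ((s : ℤ) : ℝ) else 0 := by
  obtain ⟨a, b, d, habd⟩ := Submodule.mem_span_triple.1 h
  have key : ∀ x y z : ℝ, eval ![x, y, z] (a • hx + b • hy + d • hz) = eval ![x, y, z] (hCube c) :=
    fun x y z => by rw [habd]
  simp only [hCube, hx, hy, hz, smul_eval, map_add, map_sub, map_mul,
    map_pow, eval_X, eval_C, Matrix.cons_val] at key
  have hx1 := key 1 0 0
  have hy1 := key 0 1 0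
  have hz1 := key 0 0 1
  have hxy := key 1 1 0
  have hxy' := key 1 (-1) 0
  have hxz := key 1 0 1
  have hxz' := key 1 0 (-1)
  have hyz := key 0 1 1
  have hyz' := key 0 1 (-1)
  have hxyz := key 1 1 1
  have h1 : c 1 * (c 0 ^ 2 - c 2 ^ 2) = 0 := by
    linear_combination -(1 / 6) * (hxy - hxy' - hyz - hyz')
  have h0 : c 0 * (c 1 ^ 2 - c 2 ^ 2) = 0 := by
    linear_combination -(1 / 6) * (hxy + hxy' - hxz - hxz')
  have h2 : c 2 * (c 0 ^ 2 - c 1 ^ 2) = 0 := by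
    linear_combination -(1 / 6) * (hxz - hxz' - hyz + hyz')
  have h012 : c 0 * c 1 * c 2 = 0 := by
    linear_combination -(1 / 6) * (hxyz - hxy - hxz - hyz + hx1 + hy1 + hz1)
  have hunit : ∀ t : ℝ, t ^ 2 = 1 → ∃ s : ℤˣ, t = ((s : ℤ) : ℝ) := fun t ht => by
    rcases (sq_eq_sq_iff_eq_or_eq_neg.1 (ht.trans (one_pow 2).symm)) with rfl | rfl
    · exact ⟨1, by simp⟩
    · exact ⟨-1, by simp⟩
  by_cases hc0 : c 0 = 0
  · by_cases hc1 : c 1 = 0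
    · obtain ⟨s, hs⟩ := hunit (c 2) (by simpa [hc0, hc1] using hc)
      exact ⟨2, s, fun i => by fin_cases i <;> simp [hc0, hc1, hs]⟩
    · have hc2 : c 2 = 0 := by simpa [hc0, hc1] using h1
      obtain ⟨s, hs⟩ := hunit (c 1) (by simpa [hc0, hc2] using hc)
      exact ⟨1, s, fun i => by fin_cases i <;> simp [hc0, hc2, hs]⟩
  · have h12 : c 1 * c 2 = 0 := by simpa [mul_assoc, hc0] using h012
    have h12' : c 1 ^ 2 = c 2 ^ 2 := by simpa [hc0, sub_eq_zero] using h0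
    have hc1 : c 1 = 0 := by
      rw [← pow_eq_zero_iff (n := 4) (by norm_num)]
      linear_combination c 1 ^ 2 * h12' + c 1 * c 2 * h12
    have hc2 : c 2 = 0 := by
      rw [← pow_eq_zero_iff (n := 2) (by norm_num), ← h12', hc1]
      norm_num
    obtain ⟨s, hs⟩ := hunit (c 0) (by simpa [hc1, hc2] using hc)
    exact ⟨0, s, fun i => by fin_cases i <;> simp [hc1, hc2, hs]⟩

theorem stabSO3_AOct : stabSO3 AOct = OctSet := by
  refine Set.Subset.antisymm ?_ fun A hA => ⟨mem_SO3_of_mem_OctSet hA, invUnder_AOct hA⟩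
  rintro A ⟨⟨hA, hdet⟩, hinv⟩
  have hA' : Aᵀ * A = 1 := mul_eq_one_comm.1 hA
  rw [invUnder_iff, map_iotaLin_AOct] at hinv
  have hmem : ∀ p ∈ Submodule.span ℝ {hx, hy, hz}, sActHom A p ∈ Submodule.span ℝ {hx, hy, hz} :=
    fun p hp => hinv.le (Submodule.mem_map_of_mem hp)
  obtain ⟨e0, e1, e2⟩ := sActHom_hCube hA
  have hcol : ∀ j, hCube (Aᵀ j) ∈ Submodule.span ℝ {hx, hy, hz} := by
    intro j
    fin_cases j
    · exact e0 ▸ hmem _ (Submodule.subset_span (by simp))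
    · exact e1 ▸ hmem _ (Submodule.subset_span (by simp))
    · exact e2 ▸ hmem _ (Submodule.subset_span (by simp))
  have hunit : ∀ j, Aᵀ j 0 ^ 2 + Aᵀ j 1 ^ 2 + Aᵀ j 2 ^ 2 = 1 := fun j => by
    have h := congrFun (congrFun hA' j) j
    rw [Matrix.mul_apply, Fin.sum_univ_three, Matrix.one_apply_eq] at h
    simp only [← h, pow_two, Matrix.transpose_apply]
  choose π s hs using fun j => eq_single_of_hCube_mem (hunit j) (hcol j)
  set M : Matrix (Fin 3) (Fin 3) ℤ := Matrix.of fun i j => if i = π j then (s j : ℤ) else 0 with hM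
  have hAM : A = M.map (Int.castRingHom ℝ) := by
    ext i j
    rw [← Matrix.transpose_apply A, hs]
    simp [hM]
  have hdetM : M.det = 1 := by
    have h : ((M.det : ℤ) : ℝ) = 1 := by
      rw [← hdet, hAM]
      exact (Int.castRingHom ℝ).map_det M
    exact_mod_cast h
  obtain ⟨σ, hσ⟩ := exists_cubeMat_of_det_eq_one π s hdetM
  rw [← range_octHom, hAM]
  exact ⟨σ, octHom_eq_of_cubeMat hσ⟩

theorem octSet_iso : SetIsoGroup OctSet (Equiv.Perm (Fin 4)) :=
  ⟨octHom, octHom_injective, map_mul octHom, range_octHom⟩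

/-- (i) `H₃ = A_Oct ⊕ ℝe₄ ⊕ W` with all summands `Oct`-invariant;
(ii) every 3-dimensional `Oct`-invariant subspace equals `A_Oct` or `W`;
(iii) `A_Oct` is spanned by the harmonic parts of `x³, y³, z³`;
(iv) `A_Oct` is associative and `W` is not;
(v) the `SO(3)`-stabiliser of `A_Oct` equals `Oct`, which is isomorphic to `S₄`. -/
theorem stmt5 :
    (AOct ⊔ (E4line ⊔ WOct) = ⊤ ∧ AOct ⊓ (E4line ⊔ WOct) = ⊥ ∧ E4line ⊓ WOct = ⊥ ∧
      ∀ A ∈ OctSet, InvUnder A AOct ∧ InvUnder A E4line ∧ InvUnder A WOct) ∧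
    (∀ E : Submodule ℝ (Fin 7 → ℝ), Module.finrank ℝ E = 3 →
      (∀ A ∈ OctSet, InvUnder A E) → E = AOct ∨ E = WOct) ∧
    polySet AOct = (Submodule.span ℝ {hx, hy, hz} : Submodule ℝ P3) ∧
    IsAssocSubspace AOct ∧ ¬ IsAssocSubspace WOct ∧
    stabSO3 AOct = OctSet ∧ SetIsoGroup OctSet (Equiv.Perm (Fin 4)) := by
  exact ⟨⟨AOct_sup, AOct_inf, E4line_inf, fun _ hA =>
      ⟨invUnder_AOct hA, invUnder_E4line hA, invUnder_WOct hA⟩⟩,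
    fun _ hE hinv => eq_AOct_or_eq_WOct hE hinv,
    by rw [polySet_eq, map_iotaLin_AOct], isAssoc_AOct, not_isAssoc_WOct, stabSO3_AOct, octSet_iso⟩
end
end
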